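/- Let M be the ideal of 𝕂[T_{ij},S_k] generated by g_1,…,g_{r−c} together with all (r−c)×(r−c) minors of the formal Jacobian matrix (∂g_t/∂x). Then the Krull dimension of 𝕂[T_{ij},S_k]/M is at most n+m−r−1; equivalently, the set of points z ∈ X̄ at which J(z) does not have full rank r−c has codimension at least c+1 in X̄. -/

import Mathlib

open MvPolynomial

noncomputable section

/-- Index type for the variables `T i j` (`Sum.inl ⟨i, j⟩`) and `S k` (`Sum.inr k`). -/
abbrev VarIdx (r m : ℕ) (nn : Fin (r + 1) → ℕ) : Type :=
  (Σ i : Fin (r + 1), Fin (nn i)) ⊕ Fin m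

variable (𝕂 : Type) [Field 𝕂]

/-- The monomial `T_i^{l_i} = ∏_j T_{ij}^{l_{ij}}`. -/
def Tmon (r m : ℕ) (nn : Fin (r + 1) → ℕ)
    (l : ∀ i : Fin (r + 1), Fin (nn i) → ℕ) (i : Fin (r + 1)) :
    MvPolynomial (VarIdx r m nn) 𝕂 :=
  ∏ j : Fin (nn i), (X (Sum.inl ⟨i, j⟩) : MvPolynomial (VarIdx r m nn) 𝕂) ^ l i j

/-- The map sending a column index of the `(c+2)×(c+2)` matrix defining `g_t`
to the corresponding column index of `A`, namely `0, …, c, c + (t+1)`. -/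
def colOf (r c : ℕ) (hcr : c ≤ r) (t : Fin (r - c)) (p : Fin (c + 2)) : Fin (r + 1) :=
  if h : (p : ℕ) ≤ c then ⟨p, by omega⟩
  else ⟨c + 1 + t, by have := t.isLt; omega⟩

/-- The polynomial `g_t`: the determinant of the `(c+2)×(c+2)` matrix whose first
`c+1` rows are formed by the columns `a_0, …, a_c, a_{c+t}` of `A` (as constant
polynomials) and whose last row is `(T_0^{l_0}, …, T_c^{l_c}, T_{c+t}^{l_{c+t}})`. -/
def gPoly (r c m : ℕ) (hcr : c ≤ r) (nn : Fin (r + 1) → ℕ)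
    (l : ∀ i : Fin (r + 1), Fin (nn i) → ℕ)
    (A : Matrix (Fin (c + 1)) (Fin (r + 1)) 𝕂) (t : Fin (r - c)) :
    MvPolynomial (VarIdx r m nn) 𝕂 :=
  Matrix.det (Matrix.of fun q p : Fin (c + 2) =>
    if h : (q : ℕ) < c + 1 then C (A ⟨q, h⟩ (colOf r c hcr t p))
    else Tmon 𝕂 r m nn l (colOf r c hcr t p))

/-- The ring `R = 𝕂[T_{ij}, S_k] / ⟨g_1, …, g_{r-c}⟩`. -/
abbrev RingAP (r c m : ℕ) (hcr : c ≤ r) (nn : Fin (r + 1) → ℕ)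
    (l : ∀ i : Fin (r + 1), Fin (nn i) → ℕ)
    (A : Matrix (Fin (c + 1)) (Fin (r + 1)) 𝕂) : Type :=
  MvPolynomial (VarIdx r m nn) 𝕂 ⧸ Ideal.span (Set.range (gPoly 𝕂 r c m hcr nn l A))

end

noncomputable section
variable (𝕂 : Type) [Field 𝕂]

/-- A point `z ∈ 𝕂^{n+m}` is of big type if for every `i = 0,…,r` some
coordinate `z_{ij}` vanishes. -/
def BigType (r m : ℕ) (nn : Fin (r + 1) → ℕ) (z : VarIdx r m nn → 𝕂) : Prop :=
  ∀ i : Fin (r + 1), ∃ j : Fin (nn i), z (Sum.inl ⟨i, j⟩) = 0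

/-- A point `z ∈ 𝕂^{n+m}` is of leaf type if there is a set `I ⊆ {0,…,r}` with at most
`c` elements such that `z_{ij} = 0` implies `i ∈ I`. -/
def LeafType (r c m : ℕ) (nn : Fin (r + 1) → ℕ) (z : VarIdx r m nn → 𝕂) : Prop :=
  ∃ I : Finset (Fin (r + 1)), I.card ≤ c ∧
    ∀ (i : Fin (r + 1)) (j : Fin (nn i)), z (Sum.inl ⟨i, j⟩) = 0 → i ∈ I

/-- The Jacobian matrix of `g_1, …, g_{r-c}` evaluated at the point `z`. -/
def Jac (r c m : ℕ) (hcr : c ≤ r) (nn : Fin (r + 1) → ℕ)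
    (l : ∀ i : Fin (r + 1), Fin (nn i) → ℕ)
    (A : Matrix (Fin (c + 1)) (Fin (r + 1)) 𝕂) (z : VarIdx r m nn → 𝕂) :
    Matrix (Fin (r - c)) (VarIdx r m nn) 𝕂 :=
  Matrix.of fun t v =>
    MvPolynomial.eval z (MvPolynomial.pderiv v (gPoly 𝕂 r c m hcr nn l A t))

end

/-- If every prime over `I` contains an ideal whose quotient has dimension at most `d`, then
`R ⧸ I` has dimension at most `d`. -/
theorem ringKrullDim_quotient_le_of_forall_isPrime {R : Type*} [CommRing R] (I : Ideal R)
    (d : WithBot ℕ∞)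
    (h : ∀ P : Ideal R, P.IsPrime → I ≤ P → ∃ Q ≤ P, ringKrullDim (R ⧸ Q) ≤ d) :
    ringKrullDim (R ⧸ I) ≤ d := by
  rw [ringKrullDim_quotient]
  refine iSup_le fun p ↦ ?_
  have hmem (k) : I ≤ (p k).1.asIdeal := (p k).2
  obtain ⟨Q, hQ, hd⟩ := h _ p.head.1.isPrime (hmem 0)
  refine le_trans ?_ hd
  rw [ringKrullDim_quotient]
  let q : LTSeries (PrimeSpectrum.zeroLocus (R := R) Q) :=
    { length := p.length
      toFun := fun k ↦ ⟨(p k).1, hQ.trans (p.head_le k)⟩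
      step := fun k ↦ p.step k }
  exact le_iSup (fun q : LTSeries (PrimeSpectrum.zeroLocus (R := R) Q) ↦
    ((q.length : ℕ∞) : WithBot ℕ∞)) q

/-- Killing a set `s` of variables leaves a ring of dimension at most the number of
remaining variables. -/
theorem ringKrullDim_quotient_span_X_image_le {σ K : Type*} [Finite σ] [Field K] (s : Set σ) :
    ringKrullDim (MvPolynomial σ K ⧸ Ideal.span ((X : σ → MvPolynomial σ K) '' s)) ≤
      (sᶜ.ncard : WithBot ℕ∞) := by
  set Q := Ideal.span ((X : σ → MvPolynomial σ K) '' s)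
  let f : MvPolynomial (sᶜ : Set σ) K →ₐ[K] MvPolynomial σ K ⧸ Q :=
    aeval fun v ↦ Ideal.Quotient.mkₐ K Q (X v)
  have hX (v : σ) : Ideal.Quotient.mkₐ K Q (X v) ∈ f.range := by
    by_cases hv : v ∈ s
    · have : Ideal.Quotient.mkₐ K Q (X v) = 0 :=
        Ideal.Quotient.eq_zero_iff_mem.2 (Ideal.subset_span ⟨v, hv, rfl⟩)
      rw [this]
      exact zero_mem _
    · exact ⟨X ⟨v, hv⟩, aeval_X _ _⟩
  have hf : Function.Surjective f := by
    intro y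
    obtain ⟨x, rfl⟩ := Ideal.Quotient.mkₐ_surjective K Q y
    change _ ∈ f.range
    induction x using MvPolynomial.induction_on with
    | C a => exact f.range.algebraMap_mem a
    | add p q hp hq => rw [map_add]; exact add_mem hp hq
    | mul_X p v hp => rw [map_mul]; exact mul_mem hp (hX v)
  refine (ringKrullDim_le_of_surjective f.toRingHom hf).trans ?_
  rw [MvPolynomial.ringKrullDim_of_isNoetherianRing, ringKrullDim_eq_zero_of_field, zero_add,
    Nat.card_coe_set_eq]

section RelationMatrix

variable {𝕂 : Type} [Field 𝕂] {r c m : ℕ} {nn : Fin (r + 1) → ℕ}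

theorem colOf_injective (hcr : c ≤ r) (t : Fin (r - c)) :
    Function.Injective (colOf r c hcr t) := by
  intro p q h
  have hp := p.isLt
  have hq := q.isLt
  simp only [colOf] at h
  ext
  split_ifs at h <;> simp only [Fin.mk.injEq] at h <;> omega

/-- The cofactor of the entry in column `p` of the last row of the matrix defining `g_t`. -/
def relCofactor (hcr : c ≤ r) (A : Matrix (Fin (c + 1)) (Fin (r + 1)) 𝕂) (t : Fin (r - c))
    (p : Fin (c + 2)) : 𝕂 :=
  (-1) ^ (c + 1 + p : ℕ) *
    (Matrix.of fun q p' : Fin (c + 1) => A q (colOf r c hcr t (p.succAbove p'))).det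

/-- The matrix whose entry `(t, i)` is the coefficient of `T_i^{l_i}` in `g_t`. -/
def relMatrix (hcr : c ≤ r) (A : Matrix (Fin (c + 1)) (Fin (r + 1)) 𝕂) :
    Matrix (Fin (r - c)) (Fin (r + 1)) 𝕂 :=
  Matrix.of fun t i => ∑ p, if colOf r c hcr t p = i then relCofactor hcr A t p else 0

theorem det_eq_sum_relMatrix {B : Type*} [CommRing B] [Algebra 𝕂 B] (hcr : c ≤ r)
    (A : Matrix (Fin (c + 1)) (Fin (r + 1)) 𝕂) (t : Fin (r - c)) (w : Fin (r + 1) → B) :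
    Matrix.det (Matrix.of fun q p : Fin (c + 2) =>
      if h : (q : ℕ) < c + 1 then algebraMap 𝕂 B (A ⟨q, h⟩ (colOf r c hcr t p))
      else w (colOf r c hcr t p)) = ∑ i, algebraMap 𝕂 B (relMatrix hcr A t i) * w i := by
  simp only [relMatrix, Matrix.of_apply, map_sum, Finset.sum_mul]
  rw [Finset.sum_comm, Matrix.det_succ_row _ (Fin.last (c + 1))]
  refine Finset.sum_congr rfl fun p _ ↦ ?_
  simp only [apply_ite (algebraMap 𝕂 B), map_zero, ite_mul, zero_mul, Finset.sum_ite_eq,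
    Finset.mem_univ, if_true]
  simp only [relCofactor, map_mul, map_pow, map_neg, map_one, Fin.val_last, Matrix.of_apply,
    lt_irrefl, dif_neg, not_false_eq_true, RingHom.map_det]
  rw [mul_right_comm]
  congr 3
  ext q p'
  simp [Fin.succAbove_last, q.is_le.not_gt]

theorem gPoly_eq_sum (hcr : c ≤ r) (l : ∀ i : Fin (r + 1), Fin (nn i) → ℕ)
    (A : Matrix (Fin (c + 1)) (Fin (r + 1)) 𝕂) (t : Fin (r - c)) :
    gPoly 𝕂 r c m hcr nn l A t = ∑ i, C (relMatrix hcr A t i) * Tmon 𝕂 r m nn l i :=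
  det_eq_sum_relMatrix hcr A t (Tmon 𝕂 r m nn l)

/-- The rows of `A` are orthogonal to the rows of `relMatrix`. -/
theorem mulVec_relMatrix (hcr : c ≤ r) (A : Matrix (Fin (c + 1)) (Fin (r + 1)) 𝕂)
    (t : Fin (r - c)) : A.mulVec (relMatrix hcr A t) = 0 := by
  ext q
  have h := det_eq_sum_relMatrix hcr A t (A q)
  simp only [Algebra.algebraMap_self, RingHom.id_apply] at h
  simp only [Matrix.mulVec, dotProduct, Pi.zero_apply]
  simp only [mul_comm (A q _)]
  rw [← h]
  refine Matrix.det_zero_of_row_eq (i := q.castSucc) (j := Fin.last (c + 1))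
    (Fin.castSucc_lt_last q).ne ?_
  ext p
  simp

theorem relMatrix_diag (hcr : c ≤ r) (A : Matrix (Fin (c + 1)) (Fin (r + 1)) 𝕂)
    (s t : Fin (r - c)) (h : c + 1 + (s : ℕ) < r + 1) :
    relMatrix hcr A t ⟨c + 1 + s, h⟩ =
      if s = t then relCofactor hcr A t (Fin.last (c + 1)) else 0 := by
  rw [relMatrix, Matrix.of_apply, Finset.sum_eq_single (Fin.last (c + 1))]
  · congr 1
    simp [colOf, Fin.ext_iff, eq_comm]
  · intro p _ hp
    have hp' : (p : ℕ) ≤ c := by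
      have := Fin.val_lt_last hp
      omega
    rw [if_neg]
    simp only [colOf, hp', dif_pos, Fin.mk.injEq]
    omega
  · simp

theorem relCofactor_last_ne_zero (hcr : c ≤ r) (A : Matrix (Fin (c + 1)) (Fin (r + 1)) 𝕂)
    (hA : ∀ s : Finset (Fin (r + 1)), s.card = c + 1 →
      LinearIndependent 𝕂 fun j : s => A.transpose (j : Fin (r + 1))) (t : Fin (r - c)) :
    relCofactor hcr A t (Fin.last (c + 1)) ≠ 0 := by
  have hinj : Function.Injective fun p : Fin (c + 1) ↦ colOf r c hcr t p.castSucc :=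
    (colOf_injective hcr t).comp (Fin.castSucc_injective _)
  let s : Finset (Fin (r + 1)) :=
    Finset.univ.image fun p : Fin (c + 1) ↦ colOf r c hcr t p.castSucc
  have hs : s.card = c + 1 := by
    rw [Finset.card_image_of_injective _ hinj, Finset.card_univ, Fintype.card_fin]
  have hmem (p : Fin (c + 1)) : colOf r c hcr t p.castSucc ∈ s :=
    Finset.mem_image_of_mem _ (Finset.mem_univ p)
  let f : Fin (c + 1) → s := fun p ↦ ⟨colOf r c hcr t p.castSucc, hmem p⟩
  have hf : Function.Injective f := fun p q h ↦ hinj (congrArg Subtype.val h)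
  have hli : LinearIndependent 𝕂 fun p : Fin (c + 1) ↦
      A.transpose (colOf r c hcr t p.castSucc) :=
    (hA s hs).comp f hf
  have hunit := (Matrix.isUnit_iff_isUnit_det _).1
    (Matrix.linearIndependent_rows_iff_isUnit
      (A := Matrix.of fun p : Fin (c + 1) ↦ A.transpose (colOf r c hcr t p.castSucc)).1 hli)
  rw [← Matrix.det_transpose] at hunit
  rw [relCofactor]
  refine mul_ne_zero (pow_ne_zero _ (neg_ne_zero.2 one_ne_zero)) ?_
  simp only [Fin.succAbove_last]
  exact hunit.ne_zero

/-- All maximal minors of `relMatrix` are nonzero. -/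
theorem det_relMatrix_ne_zero (hcr : c ≤ r) (A : Matrix (Fin (c + 1)) (Fin (r + 1)) 𝕂)
    (hA : ∀ s : Finset (Fin (r + 1)), s.card = c + 1 →
      LinearIndependent 𝕂 fun j : s => A.transpose (j : Fin (r + 1)))
    (e : Fin (r - c) ↪ Fin (r + 1)) :
    (Matrix.of fun t p => relMatrix hcr A t (e p)).det ≠ 0 := by
  intro hdet
  obtain ⟨v, hv0, hv⟩ := Matrix.exists_vecMul_eq_zero_iff.2 hdet
  set y : Fin (r + 1) → 𝕂 := Matrix.vecMul v (relMatrix hcr A) with hy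
  have hye (p) : y (e p) = 0 := congrFun hv p
  have hAy : A.mulVec y = 0 := by
    rw [hy, ← Matrix.mulVec_transpose, Matrix.mulVec_mulVec]
    have : A * (relMatrix hcr A).transpose = 0 := by
      ext q t
      exact congrFun (mulVec_relMatrix hcr A t) q
    rw [this, Matrix.zero_mulVec]
  have hcard : (Finset.univ.map e)ᶜ.card = c + 1 := by
    rw [Finset.card_compl, Finset.card_map, Finset.card_univ, Fintype.card_fin, Fintype.card_fin]
    omega
  have hy0 : y = 0 := by
    have hsum : ∑ j : ((Finset.univ.map e)ᶜ : Finset (Fin (r + 1))),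
        y j • A.transpose (j : Fin (r + 1)) = 0 := by
      rw [Finset.sum_coe_sort (Finset.univ.map e)ᶜ fun j ↦ y j • A.transpose j]
      rw [Finset.sum_subset (Finset.subset_univ _)]
      · ext q
        have := congrFun hAy q
        simpa [Matrix.mulVec, dotProduct, mul_comm] using this
      · intro j _ hj
        obtain ⟨p, -, rfl⟩ := Finset.mem_map.1 (not_not.1 (mt Finset.mem_compl.2 hj))
        rw [hye, zero_smul]
    have := Fintype.linearIndependent_iff.1 (hA _ hcard) (fun j ↦ y j) hsum
    ext j
    by_cases hj : j ∈ Finset.univ.map e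
    · obtain ⟨p, -, rfl⟩ := Finset.mem_map.1 hj
      exact hye p
    · exact this ⟨j, Finset.mem_compl.2 hj⟩
  refine hv0 (funext fun s ↦ ?_)
  have hlt : c + 1 + (s : ℕ) < r + 1 := by omega
  have := congrFun hy0 ⟨c + 1 + s, hlt⟩
  simp only [hy, Matrix.vecMul, dotProduct, relMatrix_diag, Pi.zero_apply, mul_ite, mul_zero,
    Finset.sum_ite_eq, Finset.mem_univ, if_true] at this
  exact (mul_eq_zero.1 this).resolve_right (relCofactor_last_ne_zero hcr A hA s)

theorem Tmon_eq_monomial (l : ∀ i : Fin (r + 1), Fin (nn i) → ℕ) (i : Fin (r + 1)) :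
    Tmon 𝕂 r m nn l i = monomial (∑ j, Finsupp.single (Sum.inl ⟨i, j⟩) (l i j)) 1 := by
  simp [Tmon, monomial_sum_one, X_pow_eq_monomial]

theorem X_mul_pderiv_Tmon_self (l : ∀ i : Fin (r + 1), Fin (nn i) → ℕ) (i : Fin (r + 1))
    (j : Fin (nn i)) :
    X (Sum.inl ⟨i, j⟩) * pderiv (Sum.inl ⟨i, j⟩) (Tmon 𝕂 r m nn l i) =
      C (l i j : 𝕂) * Tmon 𝕂 r m nn l i := by
  rw [Tmon_eq_monomial, X_mul_pderiv_monomial]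
  simp [Finsupp.finsetSum_apply, Finsupp.single_apply]

theorem pderiv_Tmon_of_ne (l : ∀ i : Fin (r + 1), Fin (nn i) → ℕ) {i i' : Fin (r + 1)}
    (h : i ≠ i') (j : Fin (nn i)) :
    pderiv (Sum.inl ⟨i, j⟩) (Tmon 𝕂 r m nn l i') = 0 := by
  rw [Tmon_eq_monomial, pderiv_monomial]
  have (x : Fin (nn i')) : (Finsupp.single (Sum.inl ⟨i', x⟩ : VarIdx r m nn) (l i' x))
      (Sum.inl ⟨i, j⟩) = 0 :=
    Finsupp.single_eq_of_ne fun hh ↦ h (congrArg Sigma.fst (Sum.inl_injective hh))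
  simp [Finsupp.finsetSum_apply, this]

theorem pderiv_gPoly (hcr : c ≤ r) (l : ∀ i : Fin (r + 1), Fin (nn i) → ℕ)
    (A : Matrix (Fin (c + 1)) (Fin (r + 1)) 𝕂) (t : Fin (r - c)) (i : Fin (r + 1))
    (j : Fin (nn i)) :
    pderiv (Sum.inl ⟨i, j⟩) (gPoly 𝕂 r c m hcr nn l A t) =
      pderiv (Sum.inl ⟨i, j⟩) (Tmon 𝕂 r m nn l i) * C (relMatrix hcr A t i) := by
  rw [gPoly_eq_sum, map_sum, Finset.sum_eq_single i]
  · rw [pderiv_C_mul, mul_comm]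
  · intro i' _ hi'
    rw [pderiv_C_mul, pderiv_Tmon_of_ne l hi'.symm, mul_zero]
  · simp

theorem Ideal.IsPrime.C_notMem {σ : Type*} {P : Ideal (MvPolynomial σ 𝕂)} (hP : P.IsPrime)
    {a : 𝕂} (ha : a ≠ 0) : C a ∉ P := fun h ↦
  hP.ne_top (Ideal.eq_top_of_isUnit_mem _ h (ha.isUnit.map C))

/-- A prime containing the `g_t` and all monomials `T_i^{l_i}` outside `r - c` many indices
contains all of the monomials `T_i^{l_i}`. -/
theorem Tmon_mem_of_forall_gPoly_mem (hcr : c ≤ r) (l : ∀ i : Fin (r + 1), Fin (nn i) → ℕ)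
    (A : Matrix (Fin (c + 1)) (Fin (r + 1)) 𝕂)
    (hA : ∀ s : Finset (Fin (r + 1)), s.card = c + 1 →
      LinearIndependent 𝕂 fun j : s => A.transpose (j : Fin (r + 1)))
    {P : Ideal (MvPolynomial (VarIdx r m nn) 𝕂)} (hP : P.IsPrime)
    (hg : ∀ t, gPoly 𝕂 r c m hcr nn l A t ∈ P) (e : Fin (r - c) ↪ Fin (r + 1))
    (he : ∀ i ∉ Set.range e, Tmon 𝕂 r m nn l i ∈ P) (i : Fin (r + 1)) :
    Tmon 𝕂 r m nn l i ∈ P := by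
  by_cases hi : i ∈ Set.range e
  swap
  · exact he i hi
  obtain ⟨p, rfl⟩ := hi
  let φ := Ideal.Quotient.mk P
  let N : Matrix (Fin (r - c)) (Fin (r - c)) 𝕂 := Matrix.of fun t p => relMatrix hcr A t (e p)
  have hdet : ((φ.comp C).mapMatrix N).det ≠ 0 := by
    rw [← RingHom.map_det, RingHom.comp_apply, Ne, Ideal.Quotient.eq_zero_iff_mem]
    exact hP.C_notMem (det_relMatrix_ne_zero hcr A hA e)
  have hmul : ((φ.comp C).mapMatrix N).mulVec (fun p ↦ φ (Tmon 𝕂 r m nn l (e p))) = 0 := by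
    ext t
    have h := Ideal.Quotient.eq_zero_iff_mem.2 (hg t)
    rw [gPoly_eq_sum, map_sum, ← Finset.sum_subset (Finset.subset_univ (Finset.univ.map e)),
      Finset.sum_map] at h
    · simpa [Matrix.mulVec, dotProduct, N, φ] using h
    · intro i _ hi
      rw [map_mul, Ideal.Quotient.eq_zero_iff_mem.2 (he i (by simpa using hi)), mul_zero]
  exact Ideal.Quotient.eq_zero_iff_mem.1
    (congrFun (Matrix.eq_zero_of_mulVec_eq_zero hdet hmul) p)

/-- A prime containing the `g_t` and the maximal minors of the Jacobian contains all of the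
monomials `T_i^{l_i}`. -/
theorem Tmon_mem_of_minors_mem [CharZero 𝕂] (hcr : c ≤ r) (hnn : ∀ i, 0 < nn i)
    (l : ∀ i : Fin (r + 1), Fin (nn i) → ℕ) (hl : ∀ i j, 0 < l i j)
    (A : Matrix (Fin (c + 1)) (Fin (r + 1)) 𝕂)
    (hA : ∀ s : Finset (Fin (r + 1)), s.card = c + 1 →
      LinearIndependent 𝕂 fun j : s => A.transpose (j : Fin (r + 1)))
    {P : Ideal (MvPolynomial (VarIdx r m nn) 𝕂)} (hP : P.IsPrime)
    (hg : ∀ t, gPoly 𝕂 r c m hcr nn l A t ∈ P)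
    (hminor : ∀ cols : Fin (r - c) → VarIdx r m nn, Function.Injective cols →
      Matrix.det (Matrix.of fun t p : Fin (r - c) =>
        pderiv (cols p) (gPoly 𝕂 r c m hcr nn l A t)) ∈ P) (i : Fin (r + 1)) :
    Tmon 𝕂 r m nn l i ∈ P := by
  classical
  let S : Finset (Fin (r + 1)) := {i | Tmon 𝕂 r m nn l i ∉ P}
  have hrc : r - c ≤ (Finset.univ : Finset (Fin (r + 1))).card := by simp; omega
  rcases le_total (r - c) S.card with hS | hS
  · obtain ⟨s, hs, hcard⟩ := Finset.exists_subset_card_eq hS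
    let e : Fin (r - c) ↪ Fin (r + 1) := (s.orderEmbOfFin hcard).toEmbedding
    have he (p) : Tmon 𝕂 r m nn l (e p) ∉ P :=
      (Finset.mem_filter.1 (hs (s.orderEmbOfFin_mem hcard p))).2
    have hmem := hminor (fun p ↦ Sum.inl ⟨e p, ⟨0, hnn _⟩⟩) fun p q h ↦
      e.injective (congrArg Sigma.fst (Sum.inl_injective h))
    simp only [pderiv_gPoly] at hmem
    rw [Matrix.det_mul_row (fun p ↦ pderiv (Sum.inl ⟨e p, ⟨0, hnn _⟩⟩) (Tmon 𝕂 r m nn l (e p)))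
      (fun t p ↦ C (relMatrix hcr A t (e p)))] at hmem
    rcases hP.mem_or_mem hmem with h | h
    · obtain ⟨p, -, hp⟩ := hP.prod_mem_iff.1 h
      have h1 := P.mul_mem_left (X (Sum.inl ⟨e p, ⟨0, hnn _⟩⟩)) hp
      rw [X_mul_pderiv_Tmon_self] at h1
      rcases hP.mem_or_mem h1 with h2 | h2
      · exact absurd h2 (hP.C_notMem (Nat.cast_ne_zero.2 (hl _ _).ne'))
      · exact absurd h2 (he p)
    · refine absurd ?_ (hP.C_notMem (det_relMatrix_ne_zero hcr A hA e))
      rw [RingHom.map_det]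
      exact h
  · obtain ⟨s, hs, -, hcard⟩ := Finset.exists_subsuperset_card_eq (Finset.subset_univ S) hS hrc
    refine Tmon_mem_of_forall_gPoly_mem hcr l A hA hP hg
      (s.orderEmbOfFin hcard).toEmbedding (fun i hi ↦ ?_) i
    by_contra hcon
    refine hi ?_
    change i ∈ Set.range (s.orderEmbOfFin hcard)
    rw [Finset.range_orderEmbOfFin]
    exact hs (Finset.mem_filter.2 ⟨Finset.mem_univ _, hcon⟩)

end RelationMatrix

/-- Let `M` be the ideal generated by `g_1,…,g_{r−c}` together with
all `(r−c)×(r−c)` minors of the formal Jacobian matrix `(∂g_t/∂x)`.  Then the Krull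
dimension of `𝕂[T_{ij},S_k]/M` is at most `n+m−r−1`; equivalently, the locus in `X̄`
where the Jacobian drops rank has codimension at least `c+1` in `X̄`. -/
theorem statement_15
    (𝕂 : Type) [Field 𝕂] [IsAlgClosed 𝕂] [CharZero 𝕂]
    (r c m : ℕ) (hc : 0 < c) (hcr : c ≤ r)
    (nn : Fin (r + 1) → ℕ) (hnn : ∀ i, 0 < nn i)
    (l : ∀ i : Fin (r + 1), Fin (nn i) → ℕ) (hl : ∀ i j, 0 < l i j)
    (A : Matrix (Fin (c + 1)) (Fin (r + 1)) 𝕂)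
    (hA : ∀ s : Finset (Fin (r + 1)), s.card = c + 1 →
      LinearIndependent 𝕂 fun j : s => A.transpose (j : Fin (r + 1)))
    :
    ringKrullDim
      (MvPolynomial (VarIdx r m nn) 𝕂 ⧸
        Ideal.span (Set.range (gPoly 𝕂 r c m hcr nn l A) ∪
          {d | ∃ cols : Fin (r - c) → VarIdx r m nn, Function.Injective cols ∧
            d = Matrix.det (Matrix.of fun t p : Fin (r - c) =>
              MvPolynomial.pderiv (cols p) (gPoly 𝕂 r c m hcr nn l A t))})) ≤
      (((∑ i, nn i) + m - r - 1 : ℕ) : WithBot (WithTop ℕ)) := by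
  refine ringKrullDim_quotient_le_of_forall_isPrime _ _ fun P hP hMP ↦ ?_
  have hT := Tmon_mem_of_minors_mem hcr hnn l hl A hA hP
    (fun t ↦ hMP (Ideal.subset_span (Or.inl ⟨t, rfl⟩)))
    (fun cols hcols ↦ hMP (Ideal.subset_span (Or.inr ⟨cols, hcols, rfl⟩)))
  have hX (i) : ∃ j : Fin (nn i), X (Sum.inl ⟨i, j⟩) ∈ P := by
    obtain ⟨j, -, hj⟩ := hP.prod_mem_iff.1 (hT i)
    exact ⟨j, hP.mem_of_pow_mem _ hj⟩
  choose f hf using hX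
  let v : Fin (r + 1) → VarIdx r m nn := fun i ↦ Sum.inl ⟨i, f i⟩
  have hv : Function.Injective v := fun i i' h ↦ congrArg Sigma.fst (Sum.inl_injective h)
  refine ⟨Ideal.span (X '' Set.range v), ?_, ?_⟩
  · rw [Ideal.span_le]
    rintro _ ⟨_, ⟨i, rfl⟩, rfl⟩
    exact hf i
  · refine (ringKrullDim_quotient_span_X_image_le _).trans (le_of_eq ?_)
    have hcard : (Set.range v).ncard = r + 1 := by
      rw [← Nat.card_coe_set_eq, Nat.card_range_of_injective hv, Nat.card_fin]
    have h1 := Set.ncard_add_ncard_compl (Set.range v)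
    have h2 : Nat.card (VarIdx r m nn) = (∑ i, nn i) + m := by simp
    have h3 : (Set.range v)ᶜ.ncard = (∑ i, nn i) + m - r - 1 := by omega
    rw [h3]
    rfl
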